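/- Let M be a positive integer and q ∈ (1, M+1]. If q ∈ U, i.e., 1 has a unique q-expansion, then for every r ∈ (q, M+1] the Hausdorff dimension of π_{M+1}(U'_r \ U'_q) is strictly positive. -/

import Mathlib

open Set MeasureTheory Filter

noncomputable section

/-- The projection `π_q` of a digit sequence (0-indexed): `∑ d i / q^(i+1)`. -/
def piQ (q : ℝ) (d : ℕ → ℕ) : ℝ := ∑' i : ℕ, (d i : ℝ) / q ^ (i + 1)

/-- `d` is a `q`-expansion of `x` over the alphabet `{0,…,M}`. -/
def IsExpansion (M : ℕ) (q x : ℝ) (d : ℕ → ℕ) : Prop :=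
  (∀ i, d i ≤ M) ∧ piQ q d = x

/-- `U'_q`: digit sequences that are the unique `q`-expansion of their projection. -/
def UnivSeqs (M : ℕ) (q : ℝ) : Set (ℕ → ℕ) :=
  {d | (∀ i, d i ≤ M) ∧ ∀ e : ℕ → ℕ, IsExpansion M q (piQ q d) e → e = d}

/-- The set `U = U(M)` of univoque bases: `q ∈ (1, M+1]` such that `1` has a
unique `q`-expansion over `{0,…,M}`. -/
def UnivBases (M : ℕ) : Set ℝ :=
  {q | 1 < q ∧ q ≤ M + 1 ∧ ∃! d : ℕ → ℕ, IsExpansion M q 1 d}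

/-- The Komornik–Loreti constant `q'(M) = min U(M)`. -/
def KL (M : ℕ) : ℝ := sInf (UnivBases M)

/-- `(a, b)` is a connected component of `(q'(M), M+1) \ closure (U(M))`:
an open subinterval whose endpoints do not lie in that (open) set. -/
def CC (M : ℕ) (a b : ℝ) : Prop :=
  a < b ∧ Ioo a b ⊆ Ioo (KL M) (M + 1) \ closure (UnivBases M) ∧
    a ∉ Ioo (KL M) (M + 1) \ closure (UnivBases M) ∧
    b ∉ Ioo (KL M) (M + 1) \ closure (UnivBases M)

/-- `x ∈ [0, M/(q-1)]` has exactly two distinct `q`-expansions. -/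
def HasExactlyTwoExpansions (M : ℕ) (q x : ℝ) : Prop :=
  ∃ c d : ℕ → ℕ, c ≠ d ∧ IsExpansion M q x c ∧ IsExpansion M q x d ∧
    ∀ e : ℕ → ℕ, IsExpansion M q x e → e = c ∨ e = d

/-- `B_2(M)`: bases `q ∈ (1, M+1]` for which some `x ∈ [0, M/(q-1)]` has exactly
two `q`-expansions. -/
def B2 (M : ℕ) : Set ℝ :=
  {q | 1 < q ∧ q ≤ M + 1 ∧
    ∃ x ∈ Icc (0 : ℝ) (M / (q - 1)), HasExactlyTwoExpansions M q x}

/-- Strict lexicographic order on digit sequences. -/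
def seqLt (a b : ℕ → ℕ) : Prop := ∃ n, (∀ i < n, a i = b i) ∧ a n < b n

/-- Lexicographic order on digit sequences. -/
def seqLe (a b : ℕ → ℕ) : Prop := seqLt a b ∨ a = b

/-- A digit sequence is infinite if it does not end with `0^∞` after a last
nonzero digit (in particular `0^∞` is infinite). -/
def IsInfiniteSeq (a : ℕ → ℕ) : Prop := ¬∃ m, a m ≠ 0 ∧ ∀ i > m, a i = 0

/-- `a = α(q)`, the quasi-greedy `q`-expansion of `1`: the lexicographically
largest infinite `q`-expansion of `1`. -/
def IsQuasiGreedy (M : ℕ) (q : ℝ) (a : ℕ → ℕ) : Prop :=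
  IsExpansion M q 1 a ∧ IsInfiniteSeq a ∧
    ∀ b : ℕ → ℕ, IsExpansion M q 1 b → IsInfiniteSeq b → seqLe b a

/-- `b = β(q)`, the greedy `q`-expansion of `1`: the lexicographically largest
`q`-expansion of `1`. -/
def IsGreedy (M : ℕ) (q : ℝ) (b : ℕ → ℕ) : Prop :=
  IsExpansion M q 1 b ∧ ∀ c : ℕ → ℕ, IsExpansion M q 1 c → seqLe c b

/-- `w⁺`: increase the last digit of a word by one. -/
def plusWord : List ℕ → List ℕ
  | [] => []
  | [a] => [a + 1]
  | a :: b :: rest => a :: plusWord (b :: rest)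

/-- `w⁻`: decrease the last digit of a word by one. -/
def minusWord : List ℕ → List ℕ
  | [] => []
  | [a] => [a - 1]
  | a :: b :: rest => a :: minusWord (b :: rest)

/-- The reflection of a word: `\overline{w} = (M - w_1) ⋯ (M - w_k)`. -/
def reflWord (M : ℕ) (w : List ℕ) : List ℕ := w.map fun a => M - a

/-- The substitution `g(w) = w⁺ \overline{w⁺}`. -/
def gWord (M : ℕ) (w : List ℕ) : List ℕ := plusWord w ++ reflWord M (plusWord w)

/-- The periodic sequence `t^∞` determined by a word `t`. -/
def periodicSeq (t : List ℕ) (i : ℕ) : ℕ := t.getD (i % t.length) 0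

/-- Strict lexicographic order on words. -/
def wordLt (u v : List ℕ) : Prop := List.Lex (· < ·) u v

/-- Lexicographic order on words. -/
def wordLe (u v : List ℕ) : Prop := wordLt u v ∨ u = v

/-- The connected component `(q_0, q_0^*)` of `(q'(M), M+1) \ closure (U(M))` is
generated by the word `t`, and `θ = α(q_0^*)`: `α(q_0) = t^∞` and
`α(q_0^*) = lim_{n→∞} g^n(t)`, i.e. every `g^n(t)` is a prefix of `θ`. -/
def GeneratedBy (M : ℕ) (q₀ q₀star : ℝ) (t : List ℕ) (θ : ℕ → ℕ) : Prop :=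
  CC M q₀ q₀star ∧ t ≠ [] ∧ IsQuasiGreedy M q₀ (periodicSeq t) ∧
    IsQuasiGreedy M q₀star θ ∧
    ∀ n : ℕ, ∀ i < ((gWord M)^[n] t).length, ((gWord M)^[n] t).getD i 0 = θ i

/-- The sequence `d` with its first `n` digits removed. -/
def shiftSeq (n : ℕ) (d : ℕ → ℕ) : ℕ → ℕ := fun j => d (n + j)

/-- The reflection of a digit sequence. -/
def reflSeq (M : ℕ) (d : ℕ → ℕ) : ℕ → ℕ := fun j => M - d j

theorem shiftSeq_shiftSeq (m n : ℕ) (d : ℕ → ℕ) :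
    shiftSeq m (shiftSeq n d) = shiftSeq (n + m) d := by
  funext j
  simp [shiftSeq, add_assoc]

theorem shiftSeq_zero (d : ℕ → ℕ) : shiftSeq 0 d = d := by
  funext j
  simp [shiftSeq]

theorem shiftSeq_le {M : ℕ} {d : ℕ → ℕ} (hd : ∀ i, d i ≤ M) (n : ℕ) :
    ∀ i, shiftSeq n d i ≤ M := fun i => hd (n + i)

theorem reflSeq_le (M : ℕ) (d : ℕ → ℕ) : ∀ i, reflSeq M d i ≤ M := fun _ => Nat.sub_le _ _

theorem reflSeq_reflSeq {M : ℕ} {d : ℕ → ℕ} (hd : ∀ i, d i ≤ M) :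
    reflSeq M (reflSeq M d) = d := by
  funext i
  have := hd i
  simp only [reflSeq]
  omega

theorem summable_digits {M : ℕ} {q : ℝ} (hq : 1 < q) {d : ℕ → ℕ} (hd : ∀ i, d i ≤ M) :
    Summable fun i => (d i : ℝ) / q ^ (i + 1) := by
  have hq0 : 0 < q := by linarith
  have hg : Summable fun i : ℕ => (M : ℝ) / q * (q⁻¹) ^ i :=
    (summable_geometric_of_lt_one (by positivity) (inv_lt_one_of_one_lt₀ hq)).mul_left _
  refine Summable.of_nonneg_of_le (fun i => by positivity) (fun i => ?_) hg
  have : (d i : ℝ) ≤ M := by exact_mod_cast hd i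
  calc (d i : ℝ) / q ^ (i + 1) ≤ M / q ^ (i + 1) := by gcongr
    _ = (M : ℝ) / q * (q⁻¹) ^ i := by
      rw [pow_succ, inv_pow]
      field_simp

theorem piQ_nonneg {q : ℝ} (hq : 1 < q) (d : ℕ → ℕ) : 0 ≤ piQ q d :=
  tsum_nonneg fun i => by positivity

theorem piQ_eq_cons {M : ℕ} {q : ℝ} (hq : 1 < q) {d : ℕ → ℕ} (hd : ∀ i, d i ≤ M) :
    piQ q d = (d 0 + piQ q (shiftSeq 1 d)) / q := by
  have hq0 : 0 < q := by linarith
  unfold piQ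
  rw [(summable_digits hq hd).tsum_eq_zero_add, add_div, ← tsum_div_const]
  congr 1
  · simp
  · refine tsum_congr fun i => ?_
    rw [shiftSeq, add_comm 1 i, pow_succ q (i + 1), div_div]

theorem piQ_const {q : ℝ} (hq : 1 < q) (M : ℕ) : piQ q (fun _ => M) = M / (q - 1) := by
  have h := piQ_eq_cons hq (d := fun _ => M) (M := M) (fun _ => le_rfl)
  have h1 : shiftSeq 1 (fun _ => M) = fun _ => M := rfl
  rw [h1] at h
  have hq0 : q ≠ 0 := by linarith
  have hq1 : q - 1 ≠ 0 := by linarith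
  rw [eq_div_iff hq0] at h
  rw [eq_div_iff hq1]
  linarith

theorem piQ_reflSeq {M : ℕ} {q : ℝ} (hq : 1 < q) {d : ℕ → ℕ} (hd : ∀ i, d i ≤ M) :
    piQ q (reflSeq M d) = M / (q - 1) - piQ q d := by
  rw [← piQ_const hq M, eq_sub_iff_add_eq]
  unfold piQ
  rw [← (summable_digits hq (reflSeq_le M d)).tsum_add (summable_digits hq hd)]
  refine tsum_congr fun i => ?_
  rw [reflSeq, Nat.cast_sub (hd i)]
  ring

theorem piQ_le {M : ℕ} {q : ℝ} (hq : 1 < q) {d : ℕ → ℕ} (hd : ∀ i, d i ≤ M) :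
    piQ q d ≤ M / (q - 1) := by
  have := piQ_nonneg hq (reflSeq M d)
  rw [piQ_reflSeq hq hd] at this
  linarith

/-- Two sequences that agree before position `e` have projections whose difference is governed
by the digits at `e` and the tails behind it. -/
theorem piQ_sub_piQ {M : ℕ} {q : ℝ} (hq : 1 < q) {s t : ℕ → ℕ} (hs : ∀ i, s i ≤ M)
    (ht : ∀ i, t i ≤ M) {e : ℕ} (h : ∀ j < e, s j = t j) :
    piQ q s - piQ q t =
      (((s e : ℝ) - t e) + piQ q (shiftSeq (e + 1) s) - piQ q (shiftSeq (e + 1) t)) /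
        q ^ (e + 1) := by
  have hq0 : 0 < q := by linarith
  induction e generalizing s t with
  | zero =>
    rw [piQ_eq_cons hq hs, piQ_eq_cons hq ht]
    simp only [zero_add, pow_one]
    ring
  | succ e ih =>
    have key := ih (shiftSeq_le hs 1) (shiftSeq_le ht 1)
      (fun j hj => h (1 + j) (by omega))
    rw [piQ_eq_cons hq hs, piQ_eq_cons hq ht, h 0 (by omega), ← sub_div, add_sub_add_left_eq_sub,
      key, shiftSeq_shiftSeq, shiftSeq_shiftSeq, shiftSeq, shiftSeq, add_comm 1 e,
      show 1 + (e + 1) = e + 1 + 1 by omega, pow_succ q (e + 1), div_div]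

/-- Every point of `[0, M/(q-1)]` has a `q`-expansion. -/
theorem exists_isExpansion {M : ℕ} {q x : ℝ} (hq : 1 < q) (hqM : q ≤ M + 1) (hx0 : 0 ≤ x)
    (hx1 : x ≤ M / (q - 1)) : ∃ d, IsExpansion M q x d := by
  have hq0 : 0 < q := by linarith
  have hq1 : 0 < q - 1 := by linarith
  set T : ℝ → ℝ := fun y => q * y - (min M ⌊q * y⌋₊ : ℕ) with hT
  have hTb : ∀ y : ℝ, 0 ≤ y ∧ y ≤ M / (q - 1) → 0 ≤ T y ∧ T y ≤ M / (q - 1) := by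
    rintro y ⟨hy0, hy1⟩
    have hfl := Nat.floor_le (a := q * y) (by positivity)
    constructor
    · have : ((min M ⌊q * y⌋₊ : ℕ) : ℝ) ≤ ⌊q * y⌋₊ := by exact_mod_cast min_le_right _ _
      simp only [hT]
      linarith
    · rcases le_total M ⌊q * y⌋₊ with h | h
      · simp only [hT, min_eq_left h]
        have : (M : ℝ) / (q - 1) = q * (M / (q - 1)) - M := by
          field_simp
          ring
        rw [this]
        gcongr
      · simp only [hT, min_eq_right h]
        have h1 : 1 ≤ (M : ℝ) / (q - 1) := by
          rw [le_div_iff₀ hq1]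
          linarith
        have := Nat.lt_floor_add_one (q * y)
        linarith
  set X : ℕ → ℝ := fun n => T^[n] x with hX
  have hXs : ∀ n, X (n + 1) = q * X n - (min M ⌊q * X n⌋₊ : ℕ) := fun n => by
    simp only [hX, Function.iterate_succ_apply', hT]
  have hXb : ∀ n, 0 ≤ X n ∧ X n ≤ M / (q - 1) := by
    intro n
    induction n with
    | zero => exact ⟨hx0, hx1⟩
    | succ n ih =>
      rw [hXs]
      exact hTb _ ih
  refine ⟨fun n => min M ⌊q * X n⌋₊, fun i => min_le_left _ _, ?_⟩
  have hsum : ∀ n, ∑ i ∈ Finset.range n, ((min M ⌊q * X i⌋₊ : ℕ) : ℝ) / q ^ (i + 1)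
      = x - X n / q ^ n := by
    intro n
    induction n with
    | zero => simp [hX]
    | succ n ih =>
      rw [Finset.sum_range_succ, ih, hXs, pow_succ]
      field_simp
      ring
  refine HasSum.tsum_eq ((hasSum_iff_tendsto_nat_of_nonneg (fun i => by positivity) _).2 ?_)
  simp_rw [hsum]
  have hz : Tendsto (fun n => X n / q ^ n) atTop (nhds 0) := by
    refine squeeze_zero (fun n => div_nonneg (hXb n).1 (by positivity))
      (g := fun n => (M : ℝ) / (q - 1) * (q⁻¹) ^ n) (fun n => ?_) ?_
    · rw [inv_pow, div_eq_mul_inv]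
      gcongr
      exact (hXb n).2
    · simpa using (tendsto_pow_atTop_nhds_zero_of_lt_one (by positivity)
        (inv_lt_one_of_one_lt₀ hq)).const_mul ((M : ℝ) / (q - 1))
  simpa using hz.const_sub x

/-- A digit below `M` whose tail projects to at least `1` can be increased. -/
theorem exists_ne_of_one_le {M : ℕ} {q : ℝ} (hq : 1 < q) (hqM : q ≤ M + 1) {d : ℕ → ℕ}
    (hd : ∀ i, d i ≤ M) {n : ℕ} (hn : d n < M) (h : 1 ≤ piQ q (shiftSeq (n + 1) d)) :
    ∃ e, IsExpansion M q (piQ q d) e ∧ e ≠ d := by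
  obtain ⟨t, ht, hts⟩ := exists_isExpansion (x := piQ q (shiftSeq (n + 1) d) - 1) hq hqM
    (by linarith) (by linarith [piQ_le hq (shiftSeq_le hd (n + 1))])
  let e : ℕ → ℕ := fun i => if i < n then d i else if i = n then d n + 1 else t (i - (n + 1))
  have he : ∀ i, e i ≤ M := by
    intro i
    simp only [e]
    split_ifs
    exacts [hd i, hn, ht _]
  have hen : e n = d n + 1 := by simp [e]
  have hsh : shiftSeq (n + 1) e = t := by
    funext j
    simp only [shiftSeq, e]
    rw [if_neg (by omega), if_neg (by omega), Nat.add_sub_cancel_left]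
  refine ⟨e, ⟨he, ?_⟩, fun hed => ?_⟩
  · have key := piQ_sub_piQ hq he hd (e := n) (fun j hj => by simp [e, hj])
    rw [hsh, hts, hen] at key
    push_cast at key
    have : ((d n : ℝ) + 1 - d n + (piQ q (shiftSeq (n + 1) d) - 1) -
      piQ q (shiftSeq (n + 1) d)) = 0 := by ring
    rw [this, zero_div] at key
    linarith
  · have := congrFun hed n
    omega

theorem reflSeq_mem_univSeqs {M : ℕ} {q : ℝ} (hq : 1 < q) {d : ℕ → ℕ} (hd : d ∈ UnivSeqs M q) :
    reflSeq M d ∈ UnivSeqs M q := by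
  refine ⟨reflSeq_le M d, fun e ⟨he, hes⟩ => ?_⟩
  have : reflSeq M e = d := hd.2 _ ⟨reflSeq_le M e, by
    rw [piQ_reflSeq hq he, hes, piQ_reflSeq hq hd.1]
    ring⟩
  rw [← this, reflSeq_reflSeq he]

theorem piQ_shiftSeq_lt_one {M : ℕ} {q : ℝ} (hq : 1 < q) (hqM : q ≤ M + 1) {d : ℕ → ℕ}
    (hd : d ∈ UnivSeqs M q) {n : ℕ} (hn : d n < M) : piQ q (shiftSeq (n + 1) d) < 1 := by
  by_contra! h
  obtain ⟨e, he, hne⟩ := exists_ne_of_one_le hq hqM hd.1 hn h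
  exact hne (hd.2 e he)

/-- If all tails of a sequence and of its reflection project below `1`, the sequence is a unique
expansion. -/
theorem mem_univSeqs_of_lt_one {M : ℕ} {r : ℝ} (hr : 1 < r) {t : ℕ → ℕ} (ht : ∀ i, t i ≤ M)
    (h1 : ∀ n, piQ r (shiftSeq n t) < 1) (h2 : ∀ n, piQ r (shiftSeq n (reflSeq M t)) < 1) :
    t ∈ UnivSeqs M r := by
  have hr0 : 0 < r := by linarith
  have key : ∀ s u : ℕ → ℕ, (∀ i, s i ≤ M) → (∀ i, u i ≤ M) → piQ r s = piQ r u →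
      ∀ n, (∀ j < n, s j = u j) → u n < s n → 1 ≤ piQ r (shiftSeq (n + 1) u) := by
    intro s u hs hu hsu n hn hlt
    have h := piQ_sub_piQ hr hs hu hn
    rw [hsu, sub_self, eq_comm, div_eq_zero_iff] at h
    have h := h.resolve_right (by positivity)
    have h3 : (u n : ℝ) + 1 ≤ s n := by exact_mod_cast hlt
    linarith [piQ_nonneg hr (shiftSeq (n + 1) s)]
  refine ⟨ht, fun e ⟨he, hes⟩ => ?_⟩
  by_contra hne
  have hex : ∃ n, e n ≠ t n := by
    by_contra! h
    exact hne (funext h)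
  classical
  have hn := Nat.find_spec hex
  have hlt : ∀ j < Nat.find hex, e j = t j := fun j hj => not_not.1 (Nat.find_min hex hj)
  rcases lt_or_gt_of_ne hn with h | h
  · have := key (reflSeq M e) (reflSeq M t) (reflSeq_le _ _) (reflSeq_le _ _)
      (by rw [piQ_reflSeq hr he, piQ_reflSeq hr ht, hes]) (Nat.find hex)
      (fun j hj => by simp [reflSeq, hlt j hj])
      (by have := ht (Nat.find hex); simp only [reflSeq]; omega)
    exact absurd (h2 _) (not_lt.2 this)
  · exact absurd (h1 _) (not_lt.2 (key e t he ht hes _ hlt h))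

/-- If `s` first differs from an expansion `α` of `1` by a larger digit and the tails of `α`
project below `1`, then `s` projects above `1`. -/
theorem one_lt_piQ {M : ℕ} {q : ℝ} (hq : 1 < q) {α s : ℕ → ℕ} (hα : ∀ i, α i ≤ M)
    (hα1 : piQ q α = 1) (htail : ∀ n, piQ q (shiftSeq (n + 1) α) < 1) (hs : ∀ i, s i ≤ M)
    {e : ℕ} (h : ∀ j < e, s j = α j) (he : α e < s e) : 1 < piQ q s := by
  have hq0 : 0 < q := by linarith
  have key := piQ_sub_piQ hq hs hα h
  have h3 : (α e : ℝ) + 1 ≤ s e := by exact_mod_cast he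
  have : 0 < piQ q s - piQ q α := by
    rw [key]
    apply div_pos _ (by positivity)
    linarith [htail e, piQ_nonneg hq (shiftSeq (e + 1) s)]
  linarith

theorem piQ_tail_lt_one {M : ℕ} {q : ℝ} (hq : 1 < q) (hqM : q < M + 1) {α : ℕ → ℕ}
    (hα : α ∈ UnivSeqs M q) (hα1 : piQ q α = 1) (n : ℕ) : piQ q (shiftSeq (n + 1) α) < 1 := by
  have hq0 : 0 < q := by linarith
  by_contra! hc
  have hM : α n = M := by
    by_contra hne
    exact absurd (piQ_shiftSeq_lt_one hq hqM.le hα (lt_of_le_of_ne (hα.1 n) hne)) (not_lt.2 hc)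
  have h : 1 < piQ q (shiftSeq n α) := by
    rw [piQ_eq_cons hq (shiftSeq_le hα.1 n), shiftSeq_shiftSeq, lt_div_iff₀ hq0, shiftSeq,
      add_zero, hM]
    linarith
  cases n with
  | zero => rw [shiftSeq_zero, hα1] at h; exact lt_irrefl _ h
  | succ n => exact absurd (piQ_tail_lt_one hq hqM hα hα1 n) (not_lt.2 h.le)

theorem piQ_reflSeq_tail_lt_one {M : ℕ} {q : ℝ} (hq : 1 < q) (hqM : q < M + 1) {α : ℕ → ℕ}
    (hα : α ∈ UnivSeqs M q) (hα1 : piQ q α = 1) (n : ℕ) :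
    piQ q (reflSeq M (shiftSeq n α)) < 1 := by
  have hq0 : 0 < q := by linarith
  have hβ := reflSeq_mem_univSeqs hq hα
  have hzero : ∀ k, 1 ≤ piQ q (reflSeq M (shiftSeq (k + 1) α)) → α k = 0 := by
    intro k hk
    by_contra hne
    have := hα.1 k
    refine absurd (piQ_shiftSeq_lt_one hq hqM.le hβ (n := k) ?_) (not_lt.2 hk)
    simp only [reflSeq]
    omega
  cases n with
  | zero =>
    by_contra! hc
    have h1 := piQ_tail_lt_one hq hqM hα hα1 0
    have hc' : 1 ≤ piQ q (reflSeq M (shiftSeq (0 + 1) α)) := by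
      rw [piQ_reflSeq hq (shiftSeq_le hα.1 _)] at hc ⊢
      rw [shiftSeq_zero, hα1] at hc
      linarith
    have h2 := piQ_eq_cons hq hα.1
    rw [hα1, hzero 0 hc', Nat.cast_zero, eq_div_iff hq0.ne'] at h2
    rw [zero_add] at h1
    linarith
  | succ n =>
    by_contra! hc
    refine absurd (piQ_reflSeq_tail_lt_one hq hqM hα hα1 n) (not_lt.2 ?_)
    rw [piQ_eq_cons hq (reflSeq_le _ _), le_div_iff₀ hq0]
    have h2 : shiftSeq 1 (reflSeq M (shiftSeq n α)) = reflSeq M (shiftSeq (n + 1) α) := by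
      rw [← shiftSeq_shiftSeq]
      rfl
    rw [h2, reflSeq, shiftSeq, add_zero, hzero n hc]
    push_cast [Nat.sub_zero]
    linarith

/-- A sequence lexicographically larger than all of its proper tails has arbitrarily long
prefixes that are unbordered. -/
theorem exists_unbordered_prefix {α : ℕ → ℕ}
    (hup : ∀ n e, (∀ j < e, α (n + j) = α j) → α (n + e) ≤ α e)
    (hne : ∀ n, ∃ j, α (n + 1 + j) ≠ α j) (K : ℕ) :
    ∃ m, K < m ∧ ∀ i, 0 < i → i < m → ∃ j, i + j < m ∧ α (i + j) ≠ α j := by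
  classical
  have hD : ∀ i, ∃ D, 0 < i → α (i + D) ≠ α D ∧ ∀ j < D, α (i + j) = α j := by
    intro i
    rcases Nat.eq_zero_or_pos i with rfl | hi
    · exact ⟨0, fun h => absurd h (lt_irrefl _)⟩
    · obtain ⟨n, rfl⟩ : ∃ n, i = n + 1 := ⟨i - 1, by omega⟩
      exact ⟨Nat.find (hne n), fun _ => ⟨Nat.find_spec (hne n),
        fun j hj => not_not.1 (Nat.find_min (hne n) hj)⟩⟩
  choose D hD using hD
  obtain ⟨p, hp, hmax⟩ := Finset.exists_max_image (Finset.Icc 1 (K + 1)) (fun i => i + D i)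
    ⟨1, by simp⟩
  rw [Finset.mem_Icc] at hp
  have hK := hmax (K + 1) (by simp)
  refine ⟨p + D p + 1, by omega, fun i hi him => ⟨D i, ?_, (hD i hi).1⟩⟩
  rcases Nat.lt_or_ge i (K + 2) with h | h
  · have := hmax i (Finset.mem_Icc.2 ⟨hi, by omega⟩)
    omega
  · by_contra hc
    obtain ⟨hp1, hp2⟩ := hD p hp.1
    have hi2 := (hD i hi).2
    have hple : p + 1 ≤ i := by omega
    have h1 : α (p + D p) < α (D p) := lt_of_le_of_ne (hup p (D p) hp2) hp1
    have h2 : α (p + D p) = α (p + D p - i) := by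
      rw [← hi2 (p + D p - i) (by omega)]
      congr 1
      omega
    have h3 := hup (i - p) (p + D p - i) fun j hj => by
      rw [← hi2 j (by omega), ← hp2 (i - p + j) (by omega)]
      congr 1
      omega
    rw [show i - p + (p + D p - i) = D p by omega] at h3
    omega

/-- If `α` projects below `1`, then so does every sequence all of whose tails are, up to a
fixed depth, at most `α` in the lexicographic order. -/
theorem exists_depth_piQ_lt_one {M : ℕ} {r : ℝ} (hr : 1 < r) {α : ℕ → ℕ} (hα : ∀ i, α i ≤ M)
    (hα1 : piQ r α < 1) :
    ∃ N, ∀ t : ℕ → ℕ, (∀ i, t i ≤ M) →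
      (∀ n, ∀ e < N, (∀ j < e, t (n + j) = α j) → t (n + e) ≤ α e) →
      ∀ n, piQ r (shiftSeq n t) < 1 := by
  have hr0 : 0 < r := by linarith
  set C : ℝ := M + M / (r - 1) with hC
  have hδ : 0 < (1 - piQ r α) / 2 := by linarith
  have hz : Tendsto (fun n : ℕ => C * (r⁻¹) ^ n) atTop (nhds 0) := by
    simpa using (tendsto_pow_atTop_nhds_zero_of_lt_one (by positivity)
        (inv_lt_one_of_one_lt₀ hr)).const_mul C
  obtain ⟨N, hN⟩ := ((tendsto_add_atTop_iff_nat 1).2 hz).eventually (gt_mem_nhds hδ) |>.exists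
  refine ⟨N, fun t ht hle => ?_⟩
  set f : ℕ → ℝ := fun n => piQ r (shiftSeq n t) with hf
  have hbdd : BddAbove (range f) := by
    refine ⟨M / (r - 1), ?_⟩
    rintro _ ⟨n, rfl⟩
    exact piQ_le hr (shiftSeq_le ht n)
  have hfS : ∀ n, f n ≤ sSup (range f) := fun n => le_csSup hbdd ⟨n, rfl⟩
  by_contra! hcon
  obtain ⟨n₀, hn₀⟩ := hcon
  have hS : 1 ≤ sSup (range f) := hn₀.trans (hfS n₀)
  have hstep : ∀ n, f n ≤ sSup (range f) - (1 - piQ r α) / 2 := by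
    intro n
    by_cases hag : ∀ j < N, t (n + j) = α j
    · have key := piQ_sub_piQ hr (shiftSeq_le ht n) hα hag
      have h1 : (shiftSeq n t N : ℝ) ≤ M := by exact_mod_cast ht _
      have h2 := piQ_le hr (shiftSeq_le (shiftSeq_le ht n) (N + 1))
      have h3 := piQ_nonneg hr (shiftSeq (N + 1) α)
      have h4 : (0 : ℝ) ≤ α N := by positivity
      have h5 : piQ r (shiftSeq n t) - piQ r α ≤ C / r ^ (N + 1) := by
        rw [key]
        gcongr
        rw [hC]
        linarith
      rw [div_eq_mul_inv, ← inv_pow] at h5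
      simp only [hf]
      linarith
    · classical
      push Not at hag
      have hspec := Nat.find_spec hag
      have hmin := fun j (hj : j < Nat.find hag) => Nat.find_min hag hj
      set e := Nat.find hag
      have hagr : ∀ j < e, t (n + j) = α j := fun j hj => by
        have := hmin j hj
        simp only [not_and, not_not] at this
        exact this (hj.trans hspec.1)
      have hlt : t (n + e) < α e := lt_of_le_of_ne (hle n e hspec.1 hagr) hspec.2
      have key := piQ_sub_piQ hr (shiftSeq_le ht n) hα hagr
      rw [shiftSeq_shiftSeq] at key
      have h1 : (shiftSeq n t e : ℝ) + 1 ≤ α e := by exact_mod_cast hlt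
      have h2 : piQ r (shiftSeq (n + (e + 1)) t) ≤ sSup (range f) := hfS _
      have h3 := piQ_nonneg hr (shiftSeq (e + 1) α)
      have h5 : piQ r (shiftSeq n t) - piQ r α ≤ (sSup (range f) - 1) / r ^ (e + 1) := by
        rw [key]
        exact div_le_div_of_nonneg_right (by linarith) (by positivity)
      have h6 : (sSup (range f) - 1) / r ^ (e + 1) ≤ sSup (range f) - 1 :=
        div_le_self (by linarith) (one_le_pow₀ hr.le)
      simp only [hf]
      linarith
  have := csSup_le (range_nonempty f) (by rintro _ ⟨n, rfl⟩; exact hstep n)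
  linarith

/-- The concatenation of the words `w w'` (where `b k = 0`) and `w' w` (where `b k ≠ 0`), with
`w` and `w'` the prefixes of `α` of lengths `m` and `m'`. -/
def blockSeq (α : ℕ → ℕ) (m m' : ℕ) (b : ℕ → ℕ) (i : ℕ) : ℕ :=
  if b (i / (m + m')) = 0 then
    if i % (m + m') < m then α (i % (m + m')) else α (i % (m + m') - m)
  else
    if i % (m + m') < m' then α (i % (m + m')) else α (i % (m + m') - m')

section Blocks

variable {α : ℕ → ℕ} {m m' : ℕ}

theorem blockSeq_apply (b : ℕ → ℕ) (k : ℕ) {j : ℕ} (hj : j < m + m') :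
    blockSeq α m m' b ((m + m') * k + j) =
      if b k = 0 then if j < m then α j else α (j - m)
      else if j < m' then α j else α (j - m') := by
  have h1 : ((m + m') * k + j) / (m + m') = k := by
    rw [Nat.mul_add_div (by omega), Nat.div_eq_of_lt hj, add_zero]
  have h2 : ((m + m') * k + j) % (m + m') = j := by
    rw [Nat.mul_add_mod, Nat.mod_eq_of_lt hj]
  simp only [blockSeq, h1, h2]

theorem blockSeq_le {M : ℕ} (hα : ∀ i, α i ≤ M) (b : ℕ → ℕ) (i : ℕ) :
    blockSeq α m m' b i ≤ M := by
  unfold blockSeq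
  split_ifs <;> exact hα _

/-- Around each position a block sequence reads a suffix of a prefix of `α`, followed by another
prefix of `α`. -/
theorem blockSeq_structure (hm : 0 < m) (hmm : m < m') (b : ℕ → ℕ) (n : ℕ) :
    ∃ i l, i < l ∧ (l = m ∨ l = m') ∧
      (∀ j, i + j < l → blockSeq α m m' b (n + j) = α (i + j)) ∧
      ∀ j < m, blockSeq α m m' b (n + (l - i) + j) = α j := by
  obtain ⟨k, p, hp, rfl⟩ : ∃ k p, p < m + m' ∧ n = (m + m') * k + p :=
    ⟨n / (m + m'), n % (m + m'), Nat.mod_lt _ (by omega), (Nat.div_add_mod _ _).symm⟩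
  have hnext : ∀ j < m, blockSeq α m m' b ((m + m') * (k + 1) + j) = α j := fun j hj => by
    simp [blockSeq_apply b (k + 1) (show j < m + m' by omega), hj, hj.trans hmm]
  by_cases hb : b k = 0
  · rcases Nat.lt_or_ge p m with h | h
    · refine ⟨p, m, h, Or.inl rfl, fun j hj => ?_, fun j hj => ?_⟩
      · rw [add_assoc, blockSeq_apply b k (by omega), if_pos hb, if_pos hj]
      · rw [show (m + m') * k + p + (m - p) + j = (m + m') * k + (m + j) by omega,
          blockSeq_apply b k (by omega), if_pos hb, if_neg (by omega), Nat.add_sub_cancel_left]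
    · refine ⟨p - m, m', by omega, Or.inr rfl, fun j hj => ?_, fun j hj => ?_⟩
      · rw [add_assoc, blockSeq_apply b k (by omega), if_pos hb, if_neg (by omega)]
        congr 1
        omega
      · rw [← hnext j hj, mul_add]
        congr 1
        omega
  · rcases Nat.lt_or_ge p m' with h | h
    · refine ⟨p, m', h, Or.inr rfl, fun j hj => ?_, fun j hj => ?_⟩
      · rw [add_assoc, blockSeq_apply b k (by omega), if_neg hb, if_pos hj]
      · rw [show (m + m') * k + p + (m' - p) + j = (m + m') * k + (m' + j) by omega,
          blockSeq_apply b k (by omega), if_neg hb, if_neg (by omega), Nat.add_sub_cancel_left]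
    · refine ⟨p - m', m, by omega, Or.inl rfl, fun j hj => ?_, fun j hj => ?_⟩
      · rw [add_assoc, blockSeq_apply b k (by omega), if_neg hb, if_neg (by omega)]
        congr 1
        omega
      · rw [← hnext j hj, mul_add]
        congr 1
        omega

theorem blockSeq_upper (hup : ∀ n e, (∀ j < e, α (n + j) = α j) → α (n + e) ≤ α e)
    (hm : 0 < m) (hmm : m < m')
    (hw : ∀ i, 0 < i → i < m → ∃ j, i + j < m ∧ α (i + j) ≠ α j)
    (hw' : ∀ i, 0 < i → i < m' → ∃ j, i + j < m' ∧ α (i + j) ≠ α j) (b : ℕ → ℕ) (n e : ℕ)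
    (he : e < m) (h : ∀ j < e, blockSeq α m m' b (n + j) = α j) :
    blockSeq α m m' b (n + e) ≤ α e := by
  obtain ⟨i, l, hil, hl, h1, -⟩ := blockSeq_structure (α := α) hm hmm b n
  rcases Nat.lt_or_ge (i + e) l with hie | hie
  · rw [h1 e hie]
    exact hup i e fun j hj => by rw [← h1 j (by omega), h j hj]
  · have hlw : ∃ j, i + j < l ∧ α (i + j) ≠ α j := by
      rcases hl with rfl | rfl
      · exact hw i (by omega) hil
      · exact hw' i (by omega) hil
    obtain ⟨j, hj, hne⟩ := hlw
    exact absurd ((h1 j hj).symm.trans (h j (by omega))) hne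

theorem blockSeq_lower {M : ℕ} (hα : ∀ i, α i ≤ M)
    (hlo : ∀ n e, (∀ j < e, α (n + j) = M - α j) → M - α e ≤ α (n + e))
    (hm : 0 < m) (hmm : m < m') (b : ℕ → ℕ) (n e : ℕ)
    (he : e < m) (h : ∀ j < e, blockSeq α m m' b (n + j) = M - α j) :
    M - α e ≤ blockSeq α m m' b (n + e) := by
  obtain ⟨i, l, hil, hl, h1, h2⟩ := blockSeq_structure (α := α) hm hmm b n
  rcases Nat.lt_or_ge (i + e) l with hie | hie
  · rw [h1 e hie]
    exact hlo i e fun j hj => by rw [← h1 j (by omega), h j hj]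
  · have h3 := h2 (e - (l - i)) (by omega)
    rw [show n + (l - i) + (e - (l - i)) = n + e by omega] at h3
    have h4 := hlo (l - i) (e - (l - i)) fun j hj => by
      have h5 := h2 j (by omega)
      rw [add_assoc, h (l - i + j) (by omega)] at h5
      have := hα (l - i + j)
      omega
    rw [show l - i + (e - (l - i)) = e by omega] at h4
    rw [h3]
    have := hα (e - (l - i))
    omega

theorem blockSeq_last (hm : 0 < m) (hmm : m < m') (b : ℕ → ℕ) (k : ℕ) :
    blockSeq α m m' b ((m + m') * k + (m + m' - 1)) = α (m - 1) ∨
      blockSeq α m m' b ((m + m') * k + (m + m' - 1)) = α (m' - 1) := by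
  rw [blockSeq_apply b k (by omega)]
  split_ifs
  · omega
  · exact Or.inr (congrArg α (by omega))
  · omega
  · exact Or.inl (congrArg α (by omega))

end Blocks

theorem piQ_le_one_sub {M : ℕ} (hM : 0 < M) {L : ℕ} {u : ℕ → ℕ} (hu : ∀ i, u i ≤ M)
    (h : ∃ j < L, u j < M) : piQ ((M : ℝ) + 1) u ≤ 1 - 1 / ((M : ℝ) + 1) ^ L := by
  have hM' : (0 : ℝ) < M := by exact_mod_cast hM
  have hB : 1 < (M : ℝ) + 1 := by linarith
  obtain ⟨j, hj, hlt⟩ := h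
  have h1 := piQ_reflSeq hB hu
  rw [add_sub_cancel_right, div_self hM'.ne'] at h1
  have h2 : (reflSeq M u j : ℝ) / ((M : ℝ) + 1) ^ (j + 1) ≤ piQ ((M : ℝ) + 1) (reflSeq M u) :=
    (summable_digits hB (reflSeq_le M u)).le_tsum j fun i _ => by positivity
  have h3 : (1 : ℝ) ≤ reflSeq M u j := by
    have : 1 ≤ reflSeq M u j := by
      simp only [reflSeq]
      omega
    exact_mod_cast this
  have h4 : 1 / ((M : ℝ) + 1) ^ L ≤ (reflSeq M u j : ℝ) / ((M : ℝ) + 1) ^ (j + 1) := by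
    gcongr
    · exact hB.le
    · exact hj
  linarith

/-- Sequences with a digit below `M` in every window of length `L` are separated in base
`M + 1`. -/
theorem le_abs_piQ_sub {M : ℕ} (hM : 0 < M) {L : ℕ} {c c' : ℕ → ℕ} (hc : ∀ i, c i ≤ M)
    (hc' : ∀ i, c' i ≤ M) (hL : ∀ n, ∃ j < L, c (n + j) < M) (hL' : ∀ n, ∃ j < L, c' (n + j) < M)
    {x : ℕ} (hx : c x ≠ c' x) :
    1 / ((M : ℝ) + 1) ^ (x + 1 + L) ≤ |piQ ((M : ℝ) + 1) c - piQ ((M : ℝ) + 1) c'| := by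
  classical
  have hM' : (0 : ℝ) < M := by exact_mod_cast hM
  have hB : 1 < (M : ℝ) + 1 := by linarith
  have hex : ∃ n, c n ≠ c' n := ⟨x, hx⟩
  have hspec := Nat.find_spec hex
  have hmin : ∀ j < Nat.find hex, c j = c' j := fun j hj => not_not.1 (Nat.find_min hex hj)
  have hle : Nat.find hex ≤ x := Nat.find_le hx
  set n := Nat.find hex
  have key : ∀ u v : ℕ → ℕ, (∀ i, u i ≤ M) → (∀ i, v i ≤ M) → (∀ n, ∃ j < L, u (n + j) < M) →
      (∀ j < n, v j = u j) → u n < v n →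
      1 / ((M : ℝ) + 1) ^ (x + 1 + L) ≤ piQ ((M : ℝ) + 1) v - piQ ((M : ℝ) + 1) u := by
    intro u v hu hv hLu hag hlt
    rw [piQ_sub_piQ hB hv hu hag]
    have h1 : (u n : ℝ) + 1 ≤ v n := by exact_mod_cast hlt
    have h2 := piQ_le_one_sub hM (shiftSeq_le hu (n + 1)) (hLu (n + 1))
    have h3 := piQ_nonneg hB (shiftSeq (n + 1) v)
    calc 1 / ((M : ℝ) + 1) ^ (x + 1 + L) ≤ 1 / ((M : ℝ) + 1) ^ (n + 1 + L) := by
          gcongr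
          exact hB.le
      _ = (1 / ((M : ℝ) + 1) ^ L) / ((M : ℝ) + 1) ^ (n + 1) := by
          rw [pow_add, div_div, mul_comm]
      _ ≤ _ := div_le_div_of_nonneg_right (by linarith) (by positivity)
  rcases lt_or_gt_of_ne hspec with h | h
  · rw [abs_sub_comm]
    exact (key c c' hc hc' hL (fun j hj => (hmin j hj).symm) h).trans (le_abs_self _)
  · exact (key c' c hc' hc hL' hmin h).trans (le_abs_self _)

theorem abs_piQ_two_sub_le {b b' : ℕ → ℕ} (hb : ∀ i, b i ≤ 1) (hb' : ∀ i, b' i ≤ 1) {k : ℕ}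
    (h : ∀ j < k, b j = b' j) : |piQ 2 b - piQ 2 b'| ≤ (1 / 2) ^ k := by
  have h2 : (1 : ℝ) < 2 := one_lt_two
  have htail : ∀ c : ℕ → ℕ, (∀ i, c i ≤ 1) → 0 ≤ piQ 2 c ∧ piQ 2 c ≤ 1 := fun c hc =>
    ⟨piQ_nonneg h2 c, (piQ_le h2 hc).trans_eq (by norm_num)⟩
  have h3 := htail _ (shiftSeq_le hb (k + 1))
  have h4 := htail _ (shiftSeq_le hb' (k + 1))
  have h5 : (b k : ℝ) ≤ 1 := by exact_mod_cast hb k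
  have h6 : (b' k : ℝ) ≤ 1 := by exact_mod_cast hb' k
  have h7 : (0 : ℝ) ≤ b k := by positivity
  have h8 : (0 : ℝ) ≤ b' k := by positivity
  rw [piQ_sub_piQ h2 hb hb' h, abs_div, abs_of_pos (show (0 : ℝ) < 2 ^ (k + 1) by positivity),
    div_le_iff₀ (by positivity), pow_succ, ← mul_assoc, ← mul_pow]
  norm_num
  rw [abs_le]
  constructor <;> linarith

/-- A map on a subset of the line with nonempty interior which separates points at a power rate
has an image of positive Hausdorff dimension. -/
theorem dimH_image_pos {f : ℝ → ℝ} {I : Set ℝ} (hI : (interior I).Nonempty) {R : ℝ} (hR : 1 < R)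
    (h : ∀ y ∈ I, ∀ y' ∈ I, y ≠ y' →
      ∃ k : ℕ, |y - y'| ≤ (1 / 2) ^ k ∧ 1 / R ^ (k + 2) ≤ |f y - f y'|) :
    0 < dimH (f '' I) := by
  have hR0 : 0 < R := by linarith
  have hlog : 0 < Real.log R := Real.log_pos hR
  have hs : 0 < Real.log 2 / Real.log R := div_pos (Real.log_pos one_lt_two) hlog
  obtain ⟨s, hs_eq⟩ : ∃ s : NNReal, (s : ℝ) = Real.log 2 / Real.log R := ⟨⟨_, hs.le⟩, rfl⟩
  have hs0 : 0 < s := by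
    rw [← hs_eq] at hs
    exact_mod_cast hs
  have hRs : R ^ (s : ℝ) = 2 := by
    rw [Real.rpow_def_of_pos hR0, hs_eq, mul_div_cancel₀ _ hlog.ne', Real.exp_log two_pos]
  have hbound : ∀ y ∈ I, ∀ y' ∈ I, |y - y'| ≤ 4 * |f y - f y'| ^ (s : ℝ) := by
    intro y hy y' hy'
    by_cases hne : y = y'
    · rw [hne, sub_self, abs_zero]
      positivity
    obtain ⟨k, hk1, hk2⟩ := h y hy y' hy' hne
    have h1 : (1 / R ^ (k + 2)) ^ (s : ℝ) ≤ |f y - f y'| ^ (s : ℝ) :=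
      Real.rpow_le_rpow (by positivity) hk2 s.coe_nonneg
    rw [one_div, Real.inv_rpow (by positivity), ← Real.rpow_pow_comm hR0.le, hRs] at h1
    calc |y - y'| ≤ (1 / 2) ^ k := hk1
      _ = 4 * (2 ^ (k + 2))⁻¹ := by
        rw [pow_add, one_div, inv_pow]
        field_simp
        norm_num
      _ ≤ _ := by gcongr
  have hinj : InjOn f I := by
    intro y hy y' hy' hff
    have := hbound y hy y' hy'
    rw [hff, sub_self, abs_zero, Real.zero_rpow (by exact_mod_cast hs0.ne'), mul_zero] at this
    exact sub_eq_zero.1 (abs_eq_zero.1 (le_antisymm this (abs_nonneg _)))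
  have hhol : HolderOnWith 4 s (Function.invFunOn f I) (f '' I) := by
    rintro _ ⟨y, hy, rfl⟩ _ ⟨y', hy', rfl⟩
    rw [hinj.leftInvOn_invFunOn hy, hinj.leftInvOn_invFunOn hy', edist_dist, edist_dist,
      ENNReal.ofReal_rpow_of_nonneg dist_nonneg s.coe_nonneg,
      show ((4 : NNReal) : ENNReal) = ENNReal.ofReal 4 by simp,
      ← ENNReal.ofReal_mul (by norm_num)]
    exact ENNReal.ofReal_le_ofReal (hbound y hy y' hy')
  have hdim := hhol.dimH_image_le hs0
  rw [hinj.leftInvOn_invFunOn.image_image, Real.dimH_of_nonempty_interior hI] at hdim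
  by_contra hzero
  rw [not_lt, nonpos_iff_eq_zero] at hzero
  rw [hzero] at hdim
  simp at hdim

/-- If `q ∈ U`, then for every `r ∈ (q, M+1]` the Hausdorff dimension of
`π_{M+1}(U'_r \ U'_q)` is strictly positive. -/
theorem stmt0 (M : ℕ) (hM : 0 < M) (q : ℝ) (hq : q ∈ Ioc 1 ((M : ℝ) + 1))
    (hqU : q ∈ UnivBases M) :
    ∀ r ∈ Ioc q ((M : ℝ) + 1),
      0 < dimH (piQ ((M : ℝ) + 1) '' (UnivSeqs M r \ UnivSeqs M q)) := by
  rintro r ⟨hqr, hrM⟩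
  have hq1 : 1 < q := hq.1
  have hr1 : 1 < r := hq1.trans hqr
  have hqM : q < M + 1 := hqr.trans_le hrM
  obtain ⟨-, -, α, ⟨hα, hα1⟩, huniq⟩ := hqU
  have hαU : α ∈ UnivSeqs M q := ⟨hα, fun e he => huniq e (by rwa [hα1] at he)⟩
  have htail := piQ_tail_lt_one hq1 hqM hαU hα1
  have hrefl := piQ_reflSeq_tail_lt_one hq1 hqM hαU hα1
  have hup : ∀ n e, (∀ j < e, α (n + j) = α j) → α (n + e) ≤ α e := by
    intro n e h
    cases n with
    | zero => rw [zero_add]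
    | succ n =>
      by_contra! hlt
      exact lt_asymm (htail n) (one_lt_piQ hq1 hα hα1 htail (shiftSeq_le hα (n + 1)) h hlt)
  have hlo : ∀ n e, (∀ j < e, α (n + j) = M - α j) → M - α e ≤ α (n + e) := by
    intro n e h
    by_contra! hlt
    refine lt_asymm (hrefl n) (one_lt_piQ hq1 hα hα1 htail (reflSeq_le _ _) (e := e) ?_ ?_)
    · intro j hj
      have := hα j
      simp only [reflSeq, shiftSeq, h j hj]
      omega
    · have := hα (n + e)
      simp only [reflSeq, shiftSeq]
      omega
  have hne : ∀ n, ∃ j, α (n + 1 + j) ≠ α j := by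
    intro n
    by_contra! h
    have h1 := htail n
    rw [show shiftSeq (n + 1) α = α from funext h, hα1] at h1
    exact lt_irrefl _ h1
  have hαr : piQ r α < 1 := by
    obtain ⟨i, hi⟩ : ∃ i, α i ≠ 0 := by
      by_contra! h
      have : piQ q α = 0 := by simp [piQ, h]
      linarith
    rw [← hα1]
    refine Summable.tsum_lt_tsum (i := i) (fun j => ?_) ?_ (summable_digits hr1 hα)
      (summable_digits hq1 hα)
    · gcongr
    · have : (0 : ℝ) < α i := by exact_mod_cast Nat.pos_of_ne_zero hi
      gcongr
  obtain ⟨N, hN⟩ := exists_depth_piQ_lt_one hr1 hα hαr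
  obtain ⟨m, hKm, hw⟩ := exists_unbordered_prefix hup hne (N + 1)
  have hexd : ∃ d, α (m + d) ≠ α d := by
    obtain ⟨d, hd⟩ := hne (m - 1)
    exact ⟨d, by rwa [Nat.sub_add_cancel (by omega)] at hd⟩
  classical
  obtain ⟨d, hdne, hdmin⟩ : ∃ d, α (m + d) ≠ α d ∧ ∀ j < d, α (m + j) = α j :=
    ⟨Nat.find hexd, Nat.find_spec hexd, fun j hj => not_not.1 (Nat.find_min hexd hj)⟩
  have hdlt : α (m + d) < α d := lt_of_le_of_ne (hup m d hdmin) hdne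
  obtain ⟨m', hKm', hw'⟩ := exists_unbordered_prefix hup hne (m + d)
  have hm0 : 0 < m := by omega
  have hmm : m < m' := by omega
  have hlast : ∀ l, 1 < l → (∀ i, 0 < i → i < l → ∃ j, i + j < l ∧ α (i + j) ≠ α j) →
      α (l - 1) < M := by
    intro l hl hwl
    obtain ⟨j, hj, hjne⟩ := hwl (l - 1) (by omega) (by omega)
    obtain rfl : j = 0 := by omega
    exact (lt_of_le_of_ne (hup (l - 1) 0 (by simp)) hjne).trans_le (hα 0)
  set L := m + m' with hL
  have hend : ∀ b k, blockSeq α m m' b (L * k + (L - 1)) < M := by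
    intro b k
    rcases blockSeq_last (α := α) hm0 hmm b k with h | h
    · rw [h]
      exact hlast m (by omega) hw
    · rw [h]
      exact hlast m' (by omega) hw'
  have hwin : ∀ b n, ∃ j < L, blockSeq α m m' b (n + j) < M := by
    intro b n
    have h1 := Nat.div_add_mod n L
    have h2 := Nat.mod_lt n (show L > 0 by omega)
    refine ⟨L - 1 - n % L, by omega, ?_⟩
    rw [show n + (L - 1 - n % L) = L * (n / L) + (L - 1) by omega]
    exact hend b _
  have hr_mem : ∀ b, blockSeq α m m' b ∈ UnivSeqs M r := by
    intro b
    refine mem_univSeqs_of_lt_one hr1 (blockSeq_le hα b) (hN _ (blockSeq_le hα b) ?_)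
      (hN _ (reflSeq_le _ _) ?_)
    · exact fun n e he h => blockSeq_upper hup hm0 hmm hw hw' b n e (by omega) h
    · intro n e he h
      have h1 := blockSeq_lower hα hlo hm0 hmm b n e (by omega) fun j hj => by
        have h2 := h j hj
        have h3 := blockSeq_le (m := m) (m' := m') hα b (n + j)
        simp only [reflSeq] at h2
        omega
      simp only [reflSeq]
      omega
  have hq_notMem : ∀ b, b 1 = 0 → blockSeq α m m' b ∉ UnivSeqs M q := by
    intro b hb hmem
    have h1 := hend b 0
    have h2 := piQ_shiftSeq_lt_one hq1 hqM.le hmem h1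
    rw [show L * 0 + (L - 1) + 1 = L * 1 by omega] at h2
    have hdig : ∀ j < L, shiftSeq (L * 1) (blockSeq α m m' b) j =
        if j < m then α j else α (j - m) := fun j hj => by
      rw [shiftSeq, blockSeq_apply b 1 hj, if_pos hb]
    refine lt_asymm h2 (one_lt_piQ hq1 hα hα1 htail (shiftSeq_le (blockSeq_le hα b) _)
      (e := m + d) (fun j hj => ?_) ?_)
    · rw [hdig j (by omega)]
      split_ifs with hjm
      · rfl
      · rw [← hdmin (j - m) (by omega)]
        congr 1
        omega
    · rw [hdig _ (by omega), if_neg (by omega), Nat.add_sub_cancel_left]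
      exact hdlt
  have hbin : ∀ y : ℝ, ∃ b, y ∈ Ioo (0 : ℝ) (1 / 4) → IsExpansion 1 2 y b := by
    intro y
    by_cases hy : y ∈ Ioo (0 : ℝ) (1 / 4)
    · obtain ⟨b, hb⟩ := exists_isExpansion (M := 1) (q := 2) (x := y) one_lt_two (by norm_num)
        hy.1.le (by have := hy.2; norm_num; linarith)
      exact ⟨b, fun _ => hb⟩
    · exact ⟨0, fun h => absurd h hy⟩
  choose b hb using hbin
  have hb1 : ∀ y ∈ Ioo (0 : ℝ) (1 / 4), b y 1 = 0 := by
    intro y hy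
    by_contra hne
    obtain ⟨hb1, hb2⟩ := hb y hy
    have h1 : (b y 1 : ℝ) / 2 ^ (1 + 1) ≤ piQ 2 (b y) :=
      (summable_digits one_lt_two hb1).le_tsum 1 fun i _ => by positivity
    have h2 : (1 : ℝ) ≤ b y 1 := by exact_mod_cast Nat.pos_of_ne_zero hne
    have := hy.2
    rw [hb2] at h1
    norm_num at h1
    linarith
  have hM' : (0 : ℝ) < M := by exact_mod_cast hM
  have hB : 1 < (M : ℝ) + 1 := by linarith
  refine (dimH_image_pos (f := fun y => piQ ((M : ℝ) + 1) (blockSeq α m m' (b y)))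
    (I := Ioo (0 : ℝ) (1 / 4)) (R := ((M : ℝ) + 1) ^ L) ?_ (one_lt_pow₀ hB (by omega)) ?_).trans_le
    (dimH_mono ?_)
  · rw [interior_Ioo]
    exact nonempty_Ioo.2 (by norm_num)
  · intro y hy y' hy' hyy
    obtain ⟨h1, h2⟩ := hb y hy
    obtain ⟨h1', h2'⟩ := hb y' hy'
    have hex : ∃ k, b y k ≠ b y' k := by
      by_contra! h
      exact hyy (by rw [← h2, ← h2', funext h])
    have hspec := Nat.find_spec hex
    have hmin : ∀ j < Nat.find hex, b y j = b y' j := fun j hj => not_not.1 (Nat.find_min hex hj)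
    set k := Nat.find hex
    refine ⟨k, ?_, ?_⟩
    · have := abs_piQ_two_sub_le h1 h1' hmin
      rwa [h2, h2'] at this
    · have hdiff : blockSeq α m m' (b y) (L * k + (m + d)) ≠
          blockSeq α m m' (b y') (L * k + (m + d)) := by
        have := h1 k
        have := h1' k
        rw [blockSeq_apply _ k (by omega), blockSeq_apply _ k (by omega),
          if_neg (show ¬ m + d < m by omega), if_pos (show m + d < m' by omega),
          Nat.add_sub_cancel_left]
        split_ifs
        · omega
        · exact hdlt.ne'
        · exact hdlt.ne
        · omega
      refine le_trans ?_ (le_abs_piQ_sub hM (blockSeq_le hα _) (blockSeq_le hα _) (hwin _)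
        (hwin _) hdiff)
      rw [← pow_mul]
      gcongr
      · exact hB.le
      · rw [mul_add]
        omega
  · rintro _ ⟨y, hy, rfl⟩
    exact ⟨_, ⟨hr_mem _, hq_notMem _ (hb1 y hy)⟩, rfl⟩

end
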